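/- arXiv:2203.04188 — 3 statements merged into one kernel-verified Lean document; each statement's English description precedes it below -/
import Mathlib

section
/- Suppose α, β > 0, α(‖P‖ + β‖H‖²) < 1, and ρ ∈ (0, 2), and let (z^j, w^j, ξ^j, η^j) be the xPIPG iterates from arbitrary initial points ξ¹ ∈ ℝ^n, η¹ ∈ ℝ^m. Suppose the limits z̄ := lim_{j→∞} (z^{j+1} − z^j) and w̄ := lim_{j→∞} (w^{j+1} − w^j) (which exist) satisfy z̄ = 0 and w̄ = 0. Then lim_{j→∞} d(Hz^j − g | N_{K°}(w^j)) = 0 and lim_{j→∞} d(−Pz^j − q − Hᵀw^j | N_D(z^j)) = 0. -/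
open scoped RealInnerProductSpace
open Filter Topology Matrix

/-- Spectral norm (largest singular value) of a real matrix. -/
noncomputable def specNorm {ι κ : Type*} [Fintype ι] [Fintype κ] [DecidableEq κ]
    (A : Matrix ι κ ℝ) : ℝ :=
  ‖LinearMap.toContinuousLinearMap (Matrix.toEuclideanLin A)‖

/-- The linear map on Euclidean space induced by a matrix (matrix-vector product). -/
noncomputable def mvec {ι κ : Type*} [Fintype ι] [Fintype κ] [DecidableEq κ]
    (A : Matrix ι κ ℝ) (x : EuclideanSpace ℝ κ) : EuclideanSpace ℝ ι :=
  Matrix.toEuclideanLin A x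

open Classical in
/-- Projection onto a (nonempty closed convex) set: the minimizer of the distance to `x`. -/
noncomputable def proj {ι : Type*} [Fintype ι] (C : Set (EuclideanSpace ℝ ι))
    (x : EuclideanSpace ℝ ι) : EuclideanSpace ℝ ι :=
  if h : ∃ y ∈ C, ∀ c ∈ C, ‖x - y‖ ≤ ‖x - c‖ then h.choose else x

/-- Polar cone `K° = {w | ⟨w, y⟩ ≤ 0 for all y ∈ K}`. -/
def polarCone {ι : Type*} [Fintype ι] (K : Set (EuclideanSpace ℝ ι)) :
    Set (EuclideanSpace ℝ ι) := {w | ∀ y ∈ K, ⟪w, y⟫ ≤ 0}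

/-- Recession cone `rec D = {y | y + z ∈ D for all z ∈ D}`. -/
def recCone {ι : Type*} [Fintype ι] (D : Set (EuclideanSpace ℝ ι)) :
    Set (EuclideanSpace ℝ ι) := {y | ∀ z ∈ D, y + z ∈ D}

/-- Normal cone of `C` at `x`: `N_C(x) = {y | ⟨y, x' − x⟩ ≤ 0 for all x' ∈ C}`. -/
def normalCone {ι : Type*} [Fintype ι] (C : Set (EuclideanSpace ℝ ι))
    (x : EuclideanSpace ℝ ι) : Set (EuclideanSpace ℝ ι) :=
  {y | ∀ x' ∈ C, ⟪y, x' - x⟫ ≤ 0}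

/-- A closed convex cone. -/
def IsClosedConvexCone {ι : Type*} [Fintype ι] (K : Set (EuclideanSpace ℝ ι)) : Prop :=
  IsClosed K ∧ Convex ℝ K ∧ ∀ w ∈ K, ∀ c : ℝ, 0 ≤ c → c • w ∈ K

/-- Support function of `D`, valued in `EReal`: `σ_D(x) = sup_{y ∈ D} ⟨y, x⟩`. -/
noncomputable def supportF {ι : Type*} [Fintype ι] (D : Set (EuclideanSpace ℝ ι))
    (x : EuclideanSpace ℝ ι) : EReal :=
  ⨆ y : D, ((⟪(y : EuclideanSpace ℝ ι), x⟫ : ℝ) : EReal)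

/-- A sequence satisfying a perturbed contraction recursion with vanishing perturbation vanishes. -/
theorem tendsto_zero_of_le_mul_add {a b : ℕ → ℝ} {r : ℝ} (hr0 : 0 ≤ r) (hr1 : r < 1)
    (ha : ∀ j, 0 ≤ a j) (hb : Tendsto b atTop (𝓝 0))
    (h : ∀ᶠ j in atTop, a (j + 1) ≤ r * a j + b j) : Tendsto a atTop (𝓝 0) := by
  refine tendsto_order.2 ⟨fun x hx => .of_forall fun j => hx.trans_le (ha j), fun ε hε => ?_⟩
  have hδ : 0 < (1 - r) * (ε / 2) := mul_pos (by linarith) (by linarith)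
  obtain ⟨N, hN⟩ := eventually_atTop.1 (h.and (hb.eventually (gt_mem_nhds hδ)))
  have hpow : ∀ k, a (N + k) ≤ r ^ k * a N + ε / 2 := by
    intro k
    induction k with
    | zero => simpa using (half_pos hε).le
    | succ k ih =>
      obtain ⟨h1, h2⟩ := hN (N + k) (Nat.le_add_right _ _)
      have h3 := mul_le_mul_of_nonneg_left ih hr0
      rw [← Nat.add_assoc, pow_succ]
      linarith
  have hlim : Tendsto (fun k => r ^ k * a N) atTop (𝓝 0) := by
    simpa using (tendsto_pow_atTop_nhds_zero_of_lt_one hr0 hr1).mul_const (a N)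
  obtain ⟨M, hM⟩ := eventually_atTop.1 (hlim.eventually (gt_mem_nhds (half_pos hε)))
  filter_upwards [eventually_ge_atTop (N + M)] with j hj
  obtain ⟨k, rfl⟩ := Nat.exists_eq_add_of_le (show N ≤ j by omega)
  linarith [hpow k, hM k (by omega)]

/-- If the increments of `z` vanish, then the relaxed sequence `ξ` approaches `z`. -/
theorem tendsto_relaxation_sub {E : Type*} [NormedAddCommGroup E] [NormedSpace ℝ E]
    {z ξ : ℕ → E} {ρ : ℝ} (hρ : ρ ∈ Set.Ioo (0 : ℝ) 2)
    (hξ : ∀ j, 1 ≤ j → ξ (j + 1) = (1 - ρ) • ξ j + ρ • z (j + 1))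
    (hz : Tendsto (fun j => z (j + 1) - z j) atTop (𝓝 0)) :
    Tendsto (fun j => ξ j - z j) atTop (𝓝 0) := by
  rw [tendsto_zero_iff_norm_tendsto_zero]
  have hr : |1 - ρ| < 1 := abs_lt.2 ⟨by linarith [hρ.2], by linarith [hρ.1]⟩
  refine tendsto_zero_of_le_mul_add (b := fun j => |1 - ρ| * ‖z (j + 1) - z j‖)
    (abs_nonneg (1 - ρ)) hr (fun _ => norm_nonneg _) (by simpa using hz.norm.const_mul _) ?_
  filter_upwards [eventually_ge_atTop 1] with j hj
  have e : ξ (j + 1) - z (j + 1) = (1 - ρ) • ((ξ j - z j) - (z (j + 1) - z j)) := by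
    rw [hξ j hj]; module
  rw [e, norm_smul, Real.norm_eq_abs, ← mul_add]
  exact mul_le_mul_of_nonneg_left (norm_sub_le _ _) (abs_nonneg _)

theorem sub_proj_mem_normalCone {ι : Type*} [Fintype ι] {C : Set (EuclideanSpace ℝ ι)}
    (hne : C.Nonempty) (hcl : IsClosed C) (hcv : Convex ℝ C) (x : EuclideanSpace ℝ ι) :
    x - proj C x ∈ normalCone C (proj C x) := by
  have bdd : BddBelow (Set.range fun c : C => ‖x - c‖) :=
    ⟨0, by rintro _ ⟨c, rfl⟩; exact norm_nonneg _⟩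
  have hex : ∃ y ∈ C, ∀ c ∈ C, ‖x - y‖ ≤ ‖x - c‖ := by
    obtain ⟨y, hy, hmin⟩ := exists_norm_eq_iInf_of_complete_convex hne hcl.isComplete hcv x
    exact ⟨y, hy, fun c hc => hmin ▸ ciInf_le bdd ⟨c, hc⟩⟩
  have hp : proj C x = hex.choose := dif_pos hex
  rw [hp]
  obtain ⟨hy, hmin⟩ := hex.choose_spec
  have : Nonempty C := hne.to_subtype
  exact (norm_eq_iInf_iff_real_inner_le_zero hcv hy).1
    (le_antisymm (le_ciInf fun c => hmin c c.2) (ciInf_le bdd ⟨_, hy⟩))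

theorem smul_mem_normalCone {ι : Type*} [Fintype ι] {C : Set (EuclideanSpace ℝ ι)}
    {x y : EuclideanSpace ℝ ι} (hy : y ∈ normalCone C x) {c : ℝ} (hc : 0 ≤ c) :
    c • y ∈ normalCone C x := fun x' hx' => by
  rw [real_inner_smul_left]
  exact mul_nonpos_of_nonneg_of_nonpos hc (hy x' hx')

theorem zero_mem_polarCone {ι : Type*} [Fintype ι] (K : Set (EuclideanSpace ℝ ι)) :
    (0 : EuclideanSpace ℝ ι) ∈ polarCone K := fun y _ => by simp

theorem isClosed_polarCone {ι : Type*} [Fintype ι] (K : Set (EuclideanSpace ℝ ι)) :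
    IsClosed (polarCone K) := by
  simp only [polarCone, Set.ofPred_forall]
  exact isClosed_biInter fun y _ => isClosed_le (by fun_prop) continuous_const

theorem convex_polarCone {ι : Type*} [Fintype ι] (K : Set (EuclideanSpace ℝ ι)) :
    Convex ℝ (polarCone K) := by
  intro u hu v hv a b ha hb _ y hy
  rw [inner_add_left, real_inner_smul_left, real_inner_smul_left]
  exact add_nonpos (mul_nonpos_of_nonneg_of_nonpos ha (hu y hy))
    (mul_nonpos_of_nonneg_of_nonpos hb (hv y hy))

theorem continuous_mvec {ι κ : Type*} [Fintype ι] [Fintype κ] [DecidableEq κ]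
    (A : Matrix ι κ ℝ) : Continuous (mvec A) :=
  (Matrix.toEuclideanLin A).continuous_of_finiteDimensional

theorem mvec_zero {ι κ : Type*} [Fintype ι] [Fintype κ] [DecidableEq κ]
    (A : Matrix ι κ ℝ) : mvec A 0 = 0 := map_zero (Matrix.toEuclideanLin A)

theorem mvec_add {ι κ : Type*} [Fintype ι] [Fintype κ] [DecidableEq κ]
    (A : Matrix ι κ ℝ) (x y : EuclideanSpace ℝ κ) : mvec A (x + y) = mvec A x + mvec A y :=
  map_add (Matrix.toEuclideanLin A) x y

theorem tendsto_mvec_zero {ι κ : Type*} [Fintype ι] [Fintype κ] [DecidableEq κ]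
    (A : Matrix ι κ ℝ) {x : ℕ → EuclideanSpace ℝ κ} (hx : Tendsto x atTop (𝓝 0)) :
    Tendsto (fun j => mvec A (x j)) atTop (𝓝 0) := by
  have h := (continuous_mvec A).tendsto 0
  rw [mvec_zero] at h
  exact h.comp hx

theorem tendsto_infDist_zero_of_sub_mem {E : Type*} [NormedAddCommGroup E] {x d : ℕ → E}
    {S : ℕ → Set E} (hd : Tendsto d atTop (𝓝 0))
    (h : ∀ᶠ j in atTop, x (j + 1) - d j ∈ S (j + 1)) :
    Tendsto (fun j => Metric.infDist (x j) (S j)) atTop (𝓝 0) := by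
  refine (tendsto_add_atTop_iff_nat 1).1 (squeeze_zero' (.of_forall fun _ => Metric.infDist_nonneg)
    ?_ (by simpa using hd.norm))
  filter_upwards [h] with j hj
  simpa [dist_eq_norm] using Metric.infDist_le_dist_of_mem (x := x (j + 1)) hj

/-- if both minimal displacements vanish, the xPIPG iterates asymptotically
satisfy the primal-dual optimality conditions. -/
theorem stmt9 {n m : ℕ} (P : Matrix (Fin n) (Fin n) ℝ) (q : EuclideanSpace ℝ (Fin n))
    (H : Matrix (Fin m) (Fin n) ℝ) (g : EuclideanSpace ℝ (Fin m))
    (D : Set (EuclideanSpace ℝ (Fin n))) (K : Set (EuclideanSpace ℝ (Fin m)))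
    (hP : P.PosSemidef)
    (hDne : D.Nonempty) (hDcl : IsClosed D) (hDcv : Convex ℝ D)
    (hKne : K.Nonempty) (hK : IsClosedConvexCone K)
    (α β ρ : ℝ) (hα : 0 < α) (hβ : 0 < β)
    (hstep : α * (specNorm P + β * specNorm H ^ 2) < 1)
    (hρ : ρ ∈ Set.Ioo (0 : ℝ) 2)
    (z ξ : ℕ → EuclideanSpace ℝ (Fin n)) (w η : ℕ → EuclideanSpace ℝ (Fin m))
    (hz : ∀ j, 1 ≤ j → z (j + 1) = proj D (ξ j - α • (mvec P (ξ j) + q + mvec Hᵀ (η j))))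
    (hw : ∀ j, 1 ≤ j → w (j + 1) =
      proj (polarCone K) (η j + β • (mvec H ((2 : ℝ) • z (j + 1) - ξ j) - g)))
    (hξ : ∀ j, 1 ≤ j → ξ (j + 1) = (1 - ρ) • ξ j + ρ • z (j + 1))
    (hη : ∀ j, 1 ≤ j → η (j + 1) = (1 - ρ) • η j + ρ • w (j + 1))
    (hzlim : Tendsto (fun j : ℕ => z (j + 1) - z j) atTop (𝓝 (0 : EuclideanSpace ℝ (Fin n))))
    (hwlim : Tendsto (fun j : ℕ => w (j + 1) - w j) atTop (𝓝 (0 : EuclideanSpace ℝ (Fin m)))) :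
    Tendsto (fun j : ℕ =>
        Metric.infDist (mvec H (z j) - g) (normalCone (polarCone K) (w j))) atTop (𝓝 0) ∧
    Tendsto (fun j : ℕ =>
        Metric.infDist (-(mvec P (z j)) - q - mvec Hᵀ (w j)) (normalCone D (z j))) atTop (𝓝 0) := by
  have hξz : Tendsto (fun j => ξ j - z (j + 1)) atTop (𝓝 0) := by
    simpa using (tendsto_relaxation_sub hρ hξ hzlim).sub hzlim
  have hηw : Tendsto (fun j => η j - w (j + 1)) atTop (𝓝 0) := by
    simpa using (tendsto_relaxation_sub hρ hη hwlim).sub hwlim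
  constructor
  · refine tendsto_infDist_zero_of_sub_mem
      (d := fun j => mvec H (ξ j - z (j + 1)) - β⁻¹ • (η j - w (j + 1)))
      (by simpa using (tendsto_mvec_zero H hξz).sub (hηw.const_smul β⁻¹)) ?_
    filter_upwards [eventually_ge_atTop 1] with j hj
    have hmem := smul_mem_normalCone (sub_proj_mem_normalCone ⟨0, zero_mem_polarCone K⟩
      (isClosed_polarCone K) (convex_polarCone K)
      (η j + β • (mvec H ((2 : ℝ) • z (j + 1) - ξ j) - g))) (inv_nonneg.2 hβ.le)
    rw [← hw j hj] at hmem
    convert hmem using 1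
    have e : mvec H (z (j + 1)) =
        mvec H ((2 : ℝ) • z (j + 1) - ξ j) + mvec H (ξ j - z (j + 1)) := by
      rw [← mvec_add]; congr 1; module
    rw [e]
    match_scalars <;> field_simp <;> ring
  · refine tendsto_infDist_zero_of_sub_mem
      (d := fun j => mvec P (ξ j - z (j + 1)) + mvec Hᵀ (η j - w (j + 1))
        - α⁻¹ • (ξ j - z (j + 1)))
      (by simpa using ((tendsto_mvec_zero P hξz).add (tendsto_mvec_zero Hᵀ hηw)).sub
            (hξz.const_smul α⁻¹)) ?_
    filter_upwards [eventually_ge_atTop 1] with j hj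
    have hmem := smul_mem_normalCone (sub_proj_mem_normalCone hDne hDcl hDcv
      (ξ j - α • (mvec P (ξ j) + q + mvec Hᵀ (η j)))) (inv_nonneg.2 hα.le)
    rw [← hz j hj] at hmem
    convert hmem using 1
    have e₁ : mvec P (ξ j) = mvec P (z (j + 1)) + mvec P (ξ j - z (j + 1)) := by
      rw [← mvec_add, add_sub_cancel]
    have e₂ : mvec Hᵀ (η j) = mvec Hᵀ (w (j + 1)) + mvec Hᵀ (η j - w (j + 1)) := by
      rw [← mvec_add, add_sub_cancel]
    rw [e₁, e₂]
    match_scalars <;> field_simp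
end

section
/- Suppose α, β > 0, α(‖P‖ + β‖H‖²) < 1, and ρ ∈ (0, 2), and let (z^j, w^j, ξ^j, η^j) be the xPIPG iterates from arbitrary initial points ξ¹ ∈ ℝ^n, η¹ ∈ ℝ^m. If the limit z̄ := lim_{j→∞} (z^{j+1} − z^j) (which exists) is nonzero, then P z̄ = 0, ⟨q, z̄⟩ < 0, H z̄ ∈ K, and z + z̄ ∈ D for every z ∈ D; that is, z̄ is a proof of dual infeasibility of the conic optimization problem of minimizing (1/2)zᵀPz + qᵀz subject to Hz − g ∈ K and z ∈ D. -/
open scoped RealInnerProductSpace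
open Filter Topology Matrix

/-- If the increments of `f` converge, then `f k / k` converges to the same limit. -/
lemma tendsto_inv_smul_of_tendsto_increments {E : Type*} [NormedAddCommGroup E] [NormedSpace ℝ E]
    {f : ℕ → E} {l : E} (h : Tendsto (fun k => f (k + 1) - f k) atTop (𝓝 l)) :
    Tendsto (fun k : ℕ => (k : ℝ)⁻¹ • f k) atTop (𝓝 l) := by
  have h1 := h.cesaro_smul
  have h2 : Tendsto (fun k : ℕ => (k : ℝ)⁻¹ • f 0) atTop (𝓝 ((0 : ℝ) • f 0)) :=
    (tendsto_inv_atTop_nhds_zero_nat (𝕜 := ℝ)).smul_const _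
  have h3 := h1.add h2
  rw [zero_smul, add_zero] at h3
  refine h3.congr fun k => ?_
  rw [Finset.sum_range_sub, ← smul_add, sub_add_cancel]

lemma tendsto_inner_zero_of_bounded {E : Type*} [NormedAddCommGroup E] [InnerProductSpace ℝ E]
    {f g : ℕ → E} {B : ℝ} (hf : Tendsto f atTop (𝓝 0)) (hg : ∀ k, ‖g k‖ ≤ B) :
    Tendsto (fun k => ⟪f k, g k⟫) atTop (𝓝 0) := by
  have h : Tendsto (fun k => ‖f k‖ * B) atTop (𝓝 0) := by
    simpa using (tendsto_zero_iff_norm_tendsto_zero.1 hf).mul_const B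
  refine squeeze_zero_norm (fun k => ?_) h
  exact (norm_inner_le_norm _ _).trans (mul_le_mul_of_nonneg_left (hg k) (norm_nonneg _))

lemma norm_le_add_mul_of_increments_le {E : Type*} [NormedAddCommGroup E] {f : ℕ → E} {B : ℝ}
    (h : ∀ k, ‖f (k + 1) - f k‖ ≤ B) (k : ℕ) : ‖f k‖ ≤ ‖f 0‖ + k * B := by
  induction k with
  | zero => simp
  | succ k ih =>
    have h1 : ‖f (k + 1)‖ ≤ ‖f (k + 1) - f k‖ + ‖f k‖ := by
      simpa using norm_add_le (f (k + 1) - f k) (f k)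
    push_cast
    linarith [h k]

/-- A real sequence with increments at most `2 * a * j + b` is eventually below any quadratic with
leading coefficient larger than `a`. -/
lemma eventually_le_mul_sq_of_increments_le {s : ℕ → ℝ} {a b c : ℝ} (hac : a < c)
    (h : ∀ᶠ j : ℕ in atTop, s (j + 1) ≤ s j + 2 * a * j + b) :
    ∀ᶠ j : ℕ in atTop, s j ≤ c * (j : ℝ) ^ 2 := by
  obtain ⟨N, hN⟩ := eventually_atTop.1 h
  have hbd : ∀ j, N ≤ j →
      s j ≤ a * (j : ℝ) ^ 2 + (b - a) * j + (s N - a * N ^ 2 - (b - a) * N) := by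
    intro j hj
    induction j, hj using Nat.le_induction with
    | base => linarith
    | succ j hj ih =>
      push_cast
      nlinarith [hN j hj]
  set C := s N - a * N ^ 2 - (b - a) * N
  obtain ⟨M, hM⟩ := exists_nat_gt ((|b - a| + |C|) / (c - a))
  have hca : 0 < c - a := sub_pos.2 hac
  filter_upwards [eventually_ge_atTop N, eventually_ge_atTop M, eventually_ge_atTop 1]
    with j hj hjM hj1
  have h1 : (1 : ℝ) ≤ j := by exact_mod_cast hj1
  have h2 : |b - a| + |C| ≤ j * (c - a) := by
    rw [div_lt_iff₀ hca] at hM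
    have : (M : ℝ) ≤ j := by exact_mod_cast hjM
    nlinarith
  have h3 : (b - a) * j ≤ |b - a| * j := by gcongr; exact le_abs_self _
  have h4 : C ≤ |C| * j := (le_abs_self C).trans (le_mul_of_one_le_right (abs_nonneg _) h1)
  nlinarith [hbd j hj]

lemma not_increments_inner_decreasing_of_zero {F : Type*} [NormedAddCommGroup F]
    [InnerProductSpace ℝ F] {y : ℕ → F} {B κ : ℝ} (hκ : 0 < κ) (hy : y 0 = 0)
    (hB : ∀ k, ‖y (k + 1) - y k‖ ≤ B)
    (h : ∀ i, ∀ᶠ j : ℕ in atTop, ⟪y (j + 1) - y j, y j⟫ ≤ ⟪y (i + 1) - y i, y j⟫ - κ * j) :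
    False := by
  have hB0 : 0 ≤ B := (norm_nonneg _).trans (hB 0)
  have step : ∀ u : ℝ, (∀ᶠ j : ℕ in atTop, ‖y j‖ ^ 2 ≤ u * (j : ℝ) ^ 2) →
      ∀ᶠ j : ℕ in atTop, ‖y j‖ ^ 2 ≤ (u - κ / 2) * (j : ℝ) ^ 2 := by
    intro u hu
    obtain ⟨N, hN, hN1⟩ := (hu.and (eventually_ge_atTop 1)).exists
    have hNpos : (0 : ℝ) < N := by exact_mod_cast hN1
    have hall : ∀ᶠ j : ℕ in atTop, ∀ i ∈ Finset.range N,
        ⟪y (j + 1) - y j, y j⟫ ≤ ⟪y (i + 1) - y i, y j⟫ - κ * j :=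
      (Filter.eventually_all_finset _).2 fun i _ => h i
    refine eventually_le_mul_sq_of_increments_le (a := u - κ) (b := B ^ 2) (by linarith) ?_
    filter_upwards [hall, hu, eventually_ge_atTop 1] with j hj hju hj1
    have hjpos : (0 : ℝ) < j := by exact_mod_cast hj1
    have hsum := Finset.sum_le_sum hj
    rw [Finset.sum_const, Finset.sum_sub_distrib, ← sum_inner, Finset.sum_range_sub, hy, sub_zero,
      Finset.sum_const, Finset.card_range, nsmul_eq_mul, nsmul_eq_mul] at hsum
    have hcross : ⟪y N, y j⟫ ≤ N * (u * j) := by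
      have h1 := sq_nonneg ‖(j : ℝ) • y N - (N : ℝ) • y j‖
      rw [sq, norm_sub_mul_self_real, norm_smul, norm_smul, real_inner_smul_left,
        real_inner_smul_right] at h1
      simp only [Real.norm_natCast] at h1
      have h2 : (j : ℝ) ^ 2 * ‖y N‖ ^ 2 ≤ (j : ℝ) ^ 2 * (u * (N : ℝ) ^ 2) := by gcongr
      have h3 : (N : ℝ) ^ 2 * ‖y j‖ ^ 2 ≤ (N : ℝ) ^ 2 * (u * (j : ℝ) ^ 2) := by gcongr
      have h4 : ((j : ℝ) * N) * ⟪y N, y j⟫ ≤ ((j : ℝ) * N) * (N * (u * j)) := by nlinarith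
      exact le_of_mul_le_mul_left h4 (by positivity)
    have hinc : ⟪y (j + 1) - y j, y j⟫ ≤ (u - κ) * j := by
      refine le_of_mul_le_mul_left ?_ hNpos
      linarith
    have hexp : ‖y (j + 1)‖ ^ 2 =
        ‖y (j + 1) - y j‖ ^ 2 + 2 * ⟪y (j + 1) - y j, y j⟫ + ‖y j‖ ^ 2 := by
      rw [← norm_add_sq_real, sub_add_cancel]
    have hsq : ‖y (j + 1) - y j‖ ^ 2 ≤ B ^ 2 := by gcongr; exact hB j
    linarith
  have hbase : ∀ᶠ j : ℕ in atTop, ‖y j‖ ^ 2 ≤ B ^ 2 * (j : ℝ) ^ 2 := by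
    refine Eventually.of_forall fun j => ?_
    have := norm_le_add_mul_of_increments_le hB j
    rw [hy, norm_zero, zero_add] at this
    calc ‖y j‖ ^ 2 ≤ (j * B) ^ 2 := by gcongr
      _ = B ^ 2 * (j : ℝ) ^ 2 := by ring
  have hiter : ∀ n : ℕ, ∀ᶠ j : ℕ in atTop, ‖y j‖ ^ 2 ≤ (B ^ 2 - n * (κ / 2)) * (j : ℝ) ^ 2 := by
    intro n
    induction n with
    | zero => simpa using hbase
    | succ n ih =>
      have := step _ ih
      refine this.mono fun j hj => hj.trans (le_of_eq ?_)
      push_cast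
      ring
  obtain ⟨n, hn⟩ := exists_nat_gt (B ^ 2 / (κ / 2))
  rw [div_lt_iff₀ (by positivity)] at hn
  obtain ⟨j, hj, hj1⟩ := ((hiter n).and (eventually_ge_atTop 1)).exists
  have hjpos : (0 : ℝ) < j := by exact_mod_cast hj1
  have : (B ^ 2 - n * (κ / 2)) * (j : ℝ) ^ 2 < 0 :=
    mul_neg_of_neg_of_pos (by linarith) (by positivity)
  linarith [sq_nonneg ‖y j‖]

/-- For a sequence with bounded increments, the late increments cannot all point less along `y j`
than the fixed earlier ones by a margin growing linearly in `j`. -/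
lemma not_increments_inner_decreasing {F : Type*} [NormedAddCommGroup F]
    [InnerProductSpace ℝ F] {y : ℕ → F} {B κ : ℝ} (hκ : 0 < κ) (i₀ : ℕ)
    (hB : ∀ k, ‖y (k + 1) - y k‖ ≤ B)
    (h : ∀ i, i₀ ≤ i → ∀ᶠ j : ℕ in atTop,
      ⟪y (j + 1) - y j, y j⟫ ≤ ⟪y (i + 1) - y i, y j⟫ - κ * j) :
    False := by
  refine not_increments_inner_decreasing_of_zero (y := fun k => y (k + i₀) - y i₀) (B := B)
    (half_pos hκ) (by simp) (fun k => ?_) fun i => ?_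
  · rw [sub_sub_sub_cancel_right, add_right_comm]
    exact hB _
  · have h1 := (tendsto_add_atTop_nat i₀).eventually (h (i + i₀) (Nat.le_add_left _ _))
    obtain ⟨M, hM⟩ := exists_nat_gt (2 * B * ‖y i₀‖ / (κ / 2))
    rw [div_lt_iff₀ (by positivity)] at hM
    filter_upwards [h1, eventually_ge_atTop M] with j hj hjM
    have hjM' : (M : ℝ) ≤ j := by exact_mod_cast hjM
    simp only [sub_sub_sub_cancel_right, add_right_comm _ 1 i₀, inner_sub_right _ _ (y i₀)]
    push_cast at hj
    have b1 := (abs_le.1 (abs_real_inner_le_norm (y (j + i₀ + 1) - y (j + i₀)) (y i₀))).1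
    have b2 := (abs_le.1 (abs_real_inner_le_norm (y (i + i₀ + 1) - y (i + i₀)) (y i₀))).2
    have b3 := mul_le_mul_of_nonneg_right (hB (j + i₀)) (norm_nonneg (y i₀))
    have b4 := mul_le_mul_of_nonneg_right (hB (i + i₀)) (norm_nonneg (y i₀))
    have b5 : (0 : ℝ) ≤ κ * i₀ := by positivity
    nlinarith

section Orbit

variable {E F : Type*} [NormedAddCommGroup E] [InnerProductSpace ℝ E]
  [NormedAddCommGroup F] [InnerProductSpace ℝ F]

/-- The quadratic form in which the primal-dual iteration is nonexpansive. -/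
noncomputable def metricForm (P : E →L[ℝ] E) (H : E →L[ℝ] F) (α β : ℝ) (x : E) (y : F) : ℝ :=
  α⁻¹ * ‖x‖ ^ 2 - ⟪P x, x⟫ - 2 * ⟪H x, y⟫ + β⁻¹ * ‖y‖ ^ 2

/-- Orbits of the relaxed primal-dual iteration, with the projections onto `D` and `C` described by
their variational inequalities. -/
structure IsPrimalDualOrbit (P : E →L[ℝ] E) (H : E →L[ℝ] F) (Ht : F →L[ℝ] E) (q : E) (g : F)
    (D : Set E) (C : Set F) (α β ρ : ℝ) (Z X : ℕ → E) (W Y : ℕ → F) : Prop where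
  symm : ∀ x y, ⟪P x, y⟫ = ⟪x, P y⟫
  nonneg : ∀ x, 0 ≤ ⟪P x, x⟫
  adj : ∀ y x, ⟪Ht y, x⟫ = ⟪y, H x⟫
  α_pos : 0 < α
  β_pos : 0 < β
  ρ_mem : ρ ∈ Set.Ioo (0 : ℝ) 2
  coercive : ∃ μ > 0, ∀ x y, μ * (‖x‖ ^ 2 + ‖y‖ ^ 2) ≤ metricForm P H α β x y
  X_succ : ∀ k, X (k + 1) = X k + ρ • (Z k - X k)
  Y_succ : ∀ k, Y (k + 1) = Y k + ρ • (W k - Y k)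
  Z_mem : ∀ k, Z k ∈ D
  W_mem : ∀ k, W k ∈ C
  Z_normal : ∀ k, ∀ x ∈ D, ⟪α⁻¹ • (X k - Z k) - P (X k) - q - Ht (Y k), x - Z k⟫ ≤ 0
  W_normal : ∀ k, ∀ y ∈ C, ⟪β⁻¹ • (Y k - W k) + H ((2 : ℝ) • Z k - X k) - g, y - W k⟫ ≤ 0

namespace IsPrimalDualOrbit

variable {P : E →L[ℝ] E} {H : E →L[ℝ] F} {Ht : F →L[ℝ] E} {q : E} {g : F}
  {D : Set E} {C : Set F} {α β ρ : ℝ} {Z X : ℕ → E} {W Y : ℕ → F}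

/-- The residual in the normal cone of `D` at `Z k`. -/
noncomputable def primalNormal (P : E →L[ℝ] E) (Ht : F →L[ℝ] E) (q : E) (α : ℝ) (Z X : ℕ → E)
    (Y : ℕ → F) (k : ℕ) : E :=
  α⁻¹ • (X k - Z k) - P (X k) - q - Ht (Y k)

/-- The residual in the normal cone of `C` at `W k`. -/
noncomputable def dualNormal (H : E →L[ℝ] F) (g : F) (β : ℝ) (Z X : ℕ → E) (W Y : ℕ → F)
    (k : ℕ) : F :=
  β⁻¹ • (Y k - W k) + H ((2 : ℝ) • Z k - X k) - g

lemma primalNormal_monotone (h : IsPrimalDualOrbit P H Ht q g D C α β ρ Z X W Y) (k : ℕ) :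
    0 ≤ ⟪primalNormal P Ht q α Z X Y (k + 1) - primalNormal P Ht q α Z X Y k,
      Z (k + 1) - Z k⟫ := by
  have h1 := h.Z_normal k _ (h.Z_mem (k + 1))
  have h2 := h.Z_normal (k + 1) _ (h.Z_mem k)
  rw [← neg_sub (Z (k + 1)) (Z k), inner_neg_right] at h2
  rw [inner_sub_left, primalNormal, primalNormal]
  linarith

lemma dualNormal_monotone (h : IsPrimalDualOrbit P H Ht q g D C α β ρ Z X W Y) (k : ℕ) :
    0 ≤ ⟪dualNormal H g β Z X W Y (k + 1) - dualNormal H g β Z X W Y k, W (k + 1) - W k⟫ := by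
  have h1 := h.W_normal k _ (h.W_mem (k + 1))
  have h2 := h.W_normal (k + 1) _ (h.W_mem k)
  rw [← neg_sub (W (k + 1)) (W k), inner_neg_right] at h2
  rw [inner_sub_left, dualNormal, dualNormal]
  linarith

/-- Exact energy balance of one step. -/
lemma energy_balance (h : IsPrimalDualOrbit P H Ht q g D C α β ρ Z X W Y) (k : ℕ) :
    ⟪primalNormal P Ht q α Z X Y (k + 1) - primalNormal P Ht q α Z X Y k, Z (k + 1) - Z k⟫
      + ⟪dualNormal H g β Z X W Y (k + 1) - dualNormal H g β Z X W Y k, W (k + 1) - W k⟫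
      + ⟪P (Z (k + 1) - Z k), Z (k + 1) - Z k⟫
      + (1 - ρ / 2) * metricForm P H α β ((Z (k + 1) - X (k + 1)) - (Z k - X k))
          ((W (k + 1) - Y (k + 1)) - (W k - Y k))
    = ρ / 2 * (metricForm P H α β (Z k - X k) (W k - Y k)
        - metricForm P H α β (Z (k + 1) - X (k + 1)) (W (k + 1) - Y (k + 1))) := by
  obtain ⟨a, ha⟩ : ∃ a, a = Z k - X k := ⟨_, rfl⟩
  obtain ⟨a', ha'⟩ : ∃ a, a = Z (k + 1) - X (k + 1) := ⟨_, rfl⟩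
  obtain ⟨b, hb⟩ : ∃ b, b = W k - Y k := ⟨_, rfl⟩
  obtain ⟨b', hb'⟩ : ∃ b, b = W (k + 1) - Y (k + 1) := ⟨_, rfl⟩
  have hX := h.X_succ k
  have hY := h.Y_succ k
  rw [← ha] at hX
  rw [← hb] at hY
  have hZ : Z k = X k + a := by rw [ha]; abel
  have hW : W k = Y k + b := by rw [hb]; abel
  have hZ' : Z (k + 1) = X k + ρ • a + a' := by rw [ha', ← hX]; abel
  have hW' : W (k + 1) = Y k + ρ • b + b' := by rw [hb', ← hY]; abel
  have e1 : Z (k + 1) - Z k = ρ • a + a' - a := by rw [hZ', hZ]; abel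
  have e2 : W (k + 1) - W k = ρ • b + b' - b := by rw [hW', hW]; abel
  have e3 : primalNormal P Ht q α Z X Y (k + 1) - primalNormal P Ht q α Z X Y k
      = α⁻¹ • (a - a') - ρ • P a - ρ • Ht b := by
    simp only [primalNormal, hZ', hZ, hX, hY, map_add, map_smul]
    module
  have e4 : dualNormal H g β Z X W Y (k + 1) - dualNormal H g β Z X W Y k
      = β⁻¹ • (b - b') + H (ρ • a + (2 : ℝ) • a' - (2 : ℝ) • a) := by
    simp only [dualNormal, hZ', hZ, hX, hY, hW, hW', map_add, map_smul, map_sub]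
    module
  rw [e3, e4, e1, e2, ← ha, ← ha', ← hb, ← hb']
  simp only [metricForm, ← real_inner_self_eq_norm_sq, map_add, map_sub, map_smul, inner_add_left,
    inner_add_right, inner_sub_left, inner_sub_right, real_inner_smul_left, real_inner_smul_right,
    h.adj]
  have s1 : ⟪P a', a⟫ = ⟪P a, a'⟫ := by rw [h.symm, real_inner_comm]
  rw [s1, real_inner_comm a a', real_inner_comm b b', real_inner_comm (H a) b,
    real_inner_comm (H a') b]
  ring

lemma two_point_identity (h : IsPrimalDualOrbit P H Ht q g D C α β ρ Z X W Y) (i j : ℕ) :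
    ⟪primalNormal P Ht q α Z X Y j, Z j - Z i⟫ + ⟪dualNormal H g β Z X W Y j, W j⟫
      - ⟪dualNormal H g β Z X W Y i, W j⟫
    = -(α⁻¹ * ⟪Z j - X j, Z j - Z i⟫) - ⟪P (X j), Z j - Z i⟫ - ⟪q, Z j - Z i⟫
      + ⟪W j - Y j, H (Z j - Z i)⟫ - β⁻¹ * ⟪(W j - Y j) - (W i - Y i), W j⟫
      + ⟪H ((Z j - X j) - (Z i - X i)), W j⟫ := by
  simp only [primalNormal, dualNormal, map_sub, map_smul, inner_add_left, inner_sub_left,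
    inner_sub_right, real_inner_smul_left, h.adj]
  rw [real_inner_comm (H (Z j)) (W j), real_inner_comm (H (Z i)) (W j)]
  ring

lemma metricForm_nonneg (h : IsPrimalDualOrbit P H Ht q g D C α β ρ Z X W Y) (x : E) (y : F) :
    0 ≤ metricForm P H α β x y := by
  obtain ⟨μ, hμ, hc⟩ := h.coercive
  exact (by positivity : 0 ≤ μ * (‖x‖ ^ 2 + ‖y‖ ^ 2)).trans (hc x y)

lemma energy_gap_nonneg (h : IsPrimalDualOrbit P H Ht q g D C α β ρ Z X W Y) (x : E) (y : F) :
    0 ≤ (1 - ρ / 2) * metricForm P H α β x y :=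
  mul_nonneg (by linarith [h.ρ_mem.2]) (h.metricForm_nonneg x y)

lemma energy_antitone (h : IsPrimalDualOrbit P H Ht q g D C α β ρ Z X W Y) :
    Antitone fun k => metricForm P H α β (Z k - X k) (W k - Y k) := by
  refine antitone_nat_of_succ_le fun k => ?_
  have h1 := h.energy_balance k
  have h2 := h.primalNormal_monotone k
  have h3 := h.dualNormal_monotone k
  have h4 := h.nonneg (Z (k + 1) - Z k)
  have h5 := h.energy_gap_nonneg ((Z (k + 1) - X (k + 1)) - (Z k - X k))
    ((W (k + 1) - Y (k + 1)) - (W k - Y k))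
  have h6 := h.ρ_mem.1
  by_contra! hlt
  have : ρ / 2 * (metricForm P H α β (Z k - X k) (W k - Y k)
        - metricForm P H α β (Z (k + 1) - X (k + 1)) (W (k + 1) - Y (k + 1))) < 0 :=
    mul_neg_of_pos_of_neg (by linarith) (by linarith)
  linarith

lemma tendsto_energy_decrement (h : IsPrimalDualOrbit P H Ht q g D C α β ρ Z X W Y) :
    Tendsto (fun k => ρ / 2 * (metricForm P H α β (Z k - X k) (W k - Y k)
        - metricForm P H α β (Z (k + 1) - X (k + 1)) (W (k + 1) - Y (k + 1)))) atTop (𝓝 0) := by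
  have h1 := tendsto_atTop_ciInf h.energy_antitone
    ⟨0, by rintro _ ⟨k, rfl⟩; exact h.metricForm_nonneg _ _⟩
  have h2 := (h1.sub (h1.comp (tendsto_add_atTop_nat 1))).const_mul (ρ / 2)
  simpa using h2

lemma exists_norm_displacement_le (h : IsPrimalDualOrbit P H Ht q g D C α β ρ Z X W Y) :
    ∃ B, ∀ k, ‖Z k - X k‖ ≤ B ∧ ‖W k - Y k‖ ≤ B := by
  obtain ⟨μ, hμ, hc⟩ := h.coercive
  refine ⟨√(metricForm P H α β (Z 0 - X 0) (W 0 - Y 0) / μ), fun k => ?_⟩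
  have h1 := (hc (Z k - X k) (W k - Y k)).trans (h.energy_antitone (Nat.zero_le k))
  have h2 : ‖Z k - X k‖ ^ 2 + ‖W k - Y k‖ ^ 2 ≤
      metricForm P H α β (Z 0 - X 0) (W 0 - Y 0) / μ := by
    rw [le_div_iff₀ hμ]; linarith
  constructor <;> refine Real.le_sqrt_of_sq_le ?_
  · linarith [sq_nonneg ‖W k - Y k‖]
  · linarith [sq_nonneg ‖Z k - X k‖]

lemma tendsto_displacement_increments (h : IsPrimalDualOrbit P H Ht q g D C α β ρ Z X W Y) :
    Tendsto (fun k => (Z (k + 1) - X (k + 1)) - (Z k - X k)) atTop (𝓝 0) ∧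
      Tendsto (fun k => (W (k + 1) - Y (k + 1)) - (W k - Y k)) atTop (𝓝 0) := by
  obtain ⟨μ, hμ, hc⟩ := h.coercive
  have hρ : 0 < 1 - ρ / 2 := by linarith [h.ρ_mem.2]
  have hpos : 0 < (1 - ρ / 2) * μ := mul_pos hρ hμ
  have key : ∀ k, ‖(Z (k + 1) - X (k + 1)) - (Z k - X k)‖ ^ 2
      + ‖(W (k + 1) - Y (k + 1)) - (W k - Y k)‖ ^ 2
      ≤ ((1 - ρ / 2) * μ)⁻¹ * (ρ / 2 * (metricForm P H α β (Z k - X k) (W k - Y k)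
        - metricForm P H α β (Z (k + 1) - X (k + 1)) (W (k + 1) - Y (k + 1)))) := by
    intro k
    rw [inv_mul_eq_div, le_div_iff₀ hpos]
    have h1 := h.energy_balance k
    have h2 := h.primalNormal_monotone k
    have h3 := h.dualNormal_monotone k
    have h4 := h.nonneg (Z (k + 1) - Z k)
    have h5 := mul_le_mul_of_nonneg_left (hc ((Z (k + 1) - X (k + 1)) - (Z k - X k))
      ((W (k + 1) - Y (k + 1)) - (W k - Y k))) hρ.le
    linarith
  have hlim := (h.tendsto_energy_decrement.const_mul (((1 - ρ / 2) * μ)⁻¹)).sqrt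
  rw [mul_zero, Real.sqrt_zero] at hlim
  constructor
  · refine squeeze_zero_norm (fun k => Real.le_sqrt_of_sq_le ?_) hlim
    exact (le_add_of_nonneg_right (sq_nonneg _)).trans (key k)
  · refine squeeze_zero_norm (fun k => Real.le_sqrt_of_sq_le ?_) hlim
    exact (le_add_of_nonneg_left (sq_nonneg _)).trans (key k)

lemma tendsto_primal_curvature (h : IsPrimalDualOrbit P H Ht q g D C α β ρ Z X W Y) :
    Tendsto (fun k => ⟪P (Z (k + 1) - Z k), Z (k + 1) - Z k⟫) atTop (𝓝 0) := by
  refine squeeze_zero (fun k => h.nonneg _) (fun k => ?_) h.tendsto_energy_decrement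
  rw [← h.energy_balance k]
  linarith [h.primalNormal_monotone k, h.dualNormal_monotone k,
    h.energy_gap_nonneg ((Z (k + 1) - X (k + 1)) - (Z k - X k))
      ((W (k + 1) - Y (k + 1)) - (W k - Y k))]

lemma tendsto_dual_gap (h : IsPrimalDualOrbit P H Ht q g D C α β ρ Z X W Y) :
    Tendsto (fun k => ⟪dualNormal H g β Z X W Y (k + 1) - dualNormal H g β Z X W Y k,
      W (k + 1) - W k⟫) atTop (𝓝 0) := by
  refine squeeze_zero (fun k => h.dualNormal_monotone k) (fun k => ?_) h.tendsto_energy_decrement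
  rw [← h.energy_balance k]
  linarith [h.primalNormal_monotone k, h.nonneg (Z (k + 1) - Z k),
    h.energy_gap_nonneg ((Z (k + 1) - X (k + 1)) - (Z k - X k))
      ((W (k + 1) - Y (k + 1)) - (W k - Y k))]

lemma tendsto_primal_displacement (h : IsPrimalDualOrbit P H Ht q g D C α β ρ Z X W Y) {v : E}
    (hv : Tendsto (fun k => Z (k + 1) - Z k) atTop (𝓝 v)) :
    Tendsto (fun k => Z k - X k) atTop (𝓝 (ρ⁻¹ • v)) := by
  have h1 := (hv.sub h.tendsto_displacement_increments.1).const_smul ρ⁻¹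
  rw [sub_zero] at h1
  refine h1.congr fun k => ?_
  rw [h.X_succ k, inv_smul_eq_iff₀ h.ρ_mem.1.ne']
  abel

lemma map_eq_zero_of_tendsto (h : IsPrimalDualOrbit P H Ht q g D C α β ρ Z X W Y) {v : E}
    (hv : Tendsto (fun k => Z (k + 1) - Z k) atTop (𝓝 v)) : P v = 0 := by
  have h0 : ⟪P v, v⟫ = 0 :=
    tendsto_nhds_unique (((P.continuous.tendsto v).comp hv).inner hv) h.tendsto_primal_curvature
  have hc := h.nonneg (P v)
  set c := ⟪P (P v), P v⟫
  have h1 := h.nonneg (v - (‖P v‖ ^ 2 / (c + 1)) • P v)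
  simp only [map_sub, map_smul, inner_sub_left, inner_sub_right, real_inner_smul_left,
    real_inner_smul_right] at h1
  rw [h0, h.symm (P v) v, real_inner_self_eq_norm_sq] at h1
  change 0 ≤ 0 - _ - (_ - _ * (_ * c)) at h1
  have h2 : ‖P v‖ ^ 2 / (c + 1) * (c + 1) = ‖P v‖ ^ 2 := div_mul_cancel₀ _ (by positivity)
  set t := ‖P v‖ ^ 2 / (c + 1)
  have ht : t ^ 2 * (c + 2) ≤ 0 := by rw [← h2] at h1; linarith
  have ht0 : t ^ 2 = 0 := by nlinarith [sq_nonneg t]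
  rw [pow_eq_zero_iff two_ne_zero] at ht0
  rw [ht0, zero_mul] at h2
  simpa using h2.symm

lemma dualNormal_sub (k : ℕ) :
    dualNormal H g β Z X W Y (k + 1) - dualNormal H g β Z X W Y k =
      H ((Z (k + 1) - Z k) + ((Z (k + 1) - X (k + 1)) - (Z k - X k)))
        - β⁻¹ • ((W (k + 1) - Y (k + 1)) - (W k - Y k)) := by
  simp only [dualNormal, map_add, map_sub, map_smul]
  module

lemma tendsto_dualNormal_increments (h : IsPrimalDualOrbit P H Ht q g D C α β ρ Z X W Y) {v : E}
    (hv : Tendsto (fun k => Z (k + 1) - Z k) atTop (𝓝 v)) :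
    Tendsto (fun k => dualNormal H g β Z X W Y (k + 1) - dualNormal H g β Z X W Y k) atTop
      (𝓝 (H v)) := by
  obtain ⟨hu, hw⟩ := h.tendsto_displacement_increments
  have h1 := ((H.continuous.tendsto _).comp (hv.add hu)).sub (hw.const_smul β⁻¹)
  rw [add_zero, smul_zero, sub_zero] at h1
  exact h1.congr fun k => (dualNormal_sub k).symm

lemma dual_increment (h : IsPrimalDualOrbit P H Ht q g D C α β ρ Z X W Y) (k : ℕ) :
    W (k + 1) - W k = ρ • (W k - Y k) + ((W (k + 1) - Y (k + 1)) - (W k - Y k)) := by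
  rw [h.Y_succ k]
  abel

lemma tendsto_inner_dual_displacement (h : IsPrimalDualOrbit P H Ht q g D C α β ρ Z X W Y) {v : E}
    (hv : Tendsto (fun k => Z (k + 1) - Z k) atTop (𝓝 v)) :
    Tendsto (fun k => ⟪W k - Y k, H v⟫) atTop (𝓝 0) := by
  obtain ⟨B, hB⟩ := h.exists_norm_displacement_le
  have hρ := h.ρ_mem.1
  have hΔ : ∀ k, ‖W (k + 1) - W k‖ ≤ ρ * B + (B + B) := fun k => by
    rw [h.dual_increment k]
    refine (norm_add_le _ _).trans (add_le_add ?_ ?_)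
    · rw [norm_smul, Real.norm_of_nonneg hρ.le]
      exact mul_le_mul_of_nonneg_left (hB k).2 hρ.le
    · exact (norm_sub_le _ _).trans (add_le_add (hB (k + 1)).2 (hB k).2)
  have h1 : Tendsto (fun k => dualNormal H g β Z X W Y (k + 1) - dualNormal H g β Z X W Y k - H v)
      atTop (𝓝 0) := by
    simpa using (h.tendsto_dualNormal_increments hv).sub_const (H v)
  have h2 := h.tendsto_dual_gap.sub (tendsto_inner_zero_of_bounded h1 hΔ)
  have h3 := h.tendsto_displacement_increments.2.inner (𝕜 := ℝ) (tendsto_const_nhds (x := H v))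
  have h4 := (h2.sub h3).const_mul ρ⁻¹
  rw [inner_zero_left, sub_zero, sub_zero, mul_zero] at h4
  refine h4.congr fun k => ?_
  rw [← inner_sub_left, sub_sub_cancel, real_inner_comm _ (H v), ← inner_sub_left,
    h.dual_increment k, add_sub_cancel_right, real_inner_smul_left, inv_mul_cancel_left₀ hρ.ne']

lemma inner_map_limit_nonpos (h : IsPrimalDualOrbit P H Ht q g D C α β ρ Z X W Y)
    (hadd : ∀ x ∈ C, ∀ y ∈ C, x + y ∈ C) {v : E}
    (hv : Tendsto (fun k => Z (k + 1) - Z k) atTop (𝓝 v)) {y : F} (hy : y ∈ C) :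
    ⟪H v, y⟫ ≤ 0 := by
  have h1 := tendsto_inv_smul_of_tendsto_increments (h.tendsto_dualNormal_increments hv)
  refine le_of_tendsto (h1.inner tendsto_const_nhds) (Eventually.of_forall fun k => ?_)
  rw [real_inner_smul_left]
  have h2 := h.W_normal k _ (hadd _ (h.W_mem k) y hy)
  rw [add_sub_cancel_left] at h2
  exact mul_nonpos_of_nonneg_of_nonpos (by positivity) h2

lemma add_limit_mem (h : IsPrimalDualOrbit P H Ht q g D C α β ρ Z X W Y)
    (hcl : IsClosed D) (hcv : Convex ℝ D) {v : E}
    (hv : Tendsto (fun k => Z (k + 1) - Z k) atTop (𝓝 v)) {x : E} (hx : x ∈ D) :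
    x + v ∈ D := by
  have h1 := tendsto_inv_smul_of_tendsto_increments hv
  have h2 : Tendsto (fun k : ℕ => (1 - (k : ℝ)⁻¹) • x) atTop (𝓝 x) := by
    simpa using ((tendsto_inv_atTop_nhds_zero_nat (𝕜 := ℝ)).const_sub 1).smul_const x
  refine hcl.mem_of_tendsto (h2.add h1) ?_
  filter_upwards [eventually_ge_atTop 1] with k hk
  have hk1 : (k : ℝ)⁻¹ ≤ 1 := inv_le_one_of_one_le₀ (by exact_mod_cast hk)
  exact hcv hx (h.Z_mem k) (by linarith) (by positivity) (by ring)

lemma two_point_inequality (h : IsPrimalDualOrbit P H Ht q g D C α β ρ Z X W Y)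
    (hzero : 0 ∈ C) (hadd : ∀ x ∈ C, ∀ y ∈ C, x + y ∈ C) (i j : ℕ) :
    β⁻¹ * ⟪(W j - Y j) - (W i - Y i), W j⟫ ≤
      -(α⁻¹ * ⟪Z j - X j, Z j - Z i⟫) - ⟪P (X j), (Z j - X j) - Z i⟫ - ⟪q, Z j - Z i⟫
        + ⟪W j - Y j, H (Z j - Z i)⟫ + ⟪H ((Z j - X j) - (Z i - X i)), W j⟫ := by
  have h0 := h.two_point_identity i j
  have h1 := h.Z_normal j _ (h.Z_mem i)
  have h2 := h.W_normal j _ hzero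
  have h3 := h.W_normal i _ (hadd _ (h.W_mem i) _ (h.W_mem j))
  have h4 := h.nonneg (X j)
  have h5 : ⟪P (X j), Z j - Z i⟫ = ⟪P (X j), X j⟫ + ⟪P (X j), (Z j - X j) - Z i⟫ := by
    rw [← inner_add_right]; congr 1; abel
  rw [← neg_sub (Z j) (Z i), inner_neg_right] at h1
  rw [zero_sub, inner_neg_right] at h2
  rw [add_sub_cancel_left] at h3
  simp only [primalNormal, dualNormal] at h0
  linarith

lemma exists_norm_inv_smul_dual_le (h : IsPrimalDualOrbit P H Ht q g D C α β ρ Z X W Y) :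
    ∃ M, 0 ≤ M ∧ ∀ k : ℕ, ‖(k : ℝ)⁻¹ • W k‖ ≤ M := by
  obtain ⟨B, hB⟩ := h.exists_norm_displacement_le
  have hB0 : 0 ≤ B := (norm_nonneg _).trans (hB 0).1
  have hρ := h.ρ_mem.1
  have hY : ∀ k, ‖Y (k + 1) - Y k‖ ≤ ρ * B := fun k => by
    rw [h.Y_succ k, add_sub_cancel_left, norm_smul, Real.norm_of_nonneg hρ.le]
    exact mul_le_mul_of_nonneg_left (hB k).2 hρ.le
  refine ⟨B + (‖Y 0‖ + ρ * B), by positivity, fun k => ?_⟩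
  rcases Nat.eq_zero_or_pos k with rfl | hk
  · rw [Nat.cast_zero, _root_.inv_zero, zero_smul, norm_zero]; positivity
  have hk1 : (1 : ℝ) ≤ k := by exact_mod_cast hk
  have h1 : ‖W k‖ ≤ ‖W k - Y k‖ + ‖Y k‖ := by simpa using norm_add_le (W k - Y k) (Y k)
  have h2 := norm_le_add_mul_of_increments_le hY k
  rw [norm_smul, norm_inv, Real.norm_natCast, inv_mul_le_iff₀ (by linarith)]
  nlinarith [(hB k).2, norm_nonneg (Y 0)]

/-- The objective decreases along the limit direction. -/
lemma inner_add_norm_sq_nonpos (h : IsPrimalDualOrbit P H Ht q g D C α β ρ Z X W Y)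
    (hzero : 0 ∈ C) (hadd : ∀ x ∈ C, ∀ y ∈ C, x + y ∈ C) {v : E}
    (hv : Tendsto (fun k => Z (k + 1) - Z k) atTop (𝓝 v)) :
    ⟪q, v⟫ + α⁻¹ * (ρ⁻¹ * ‖v‖ ^ 2) ≤ 0 := by
  by_contra! hc
  set c := ⟪q, v⟫ + α⁻¹ * (ρ⁻¹ * ‖v‖ ^ 2) with hc_def
  obtain ⟨B, hB⟩ := h.exists_norm_displacement_le
  obtain ⟨M, hM0, hM⟩ := h.exists_norm_inv_smul_dual_le
  have hB0 : 0 ≤ B := (norm_nonneg _).trans (hB 0).1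
  have hρ := h.ρ_mem.1
  have hβ := h.β_pos
  have hδ := h.tendsto_primal_displacement hv
  have hX : Tendsto (fun k => X (k + 1) - X k) atTop (𝓝 v) := by
    have h1 := hδ.const_smul ρ
    rw [smul_inv_smul₀ hρ.ne'] at h1
    exact h1.congr fun k => by rw [h.X_succ k, add_sub_cancel_left]
  have hPX : Tendsto (fun k : ℕ => (k : ℝ)⁻¹ • P (X k)) atTop (𝓝 0) := by
    have h1 := (P.continuous.tendsto _).comp (tendsto_inv_smul_of_tendsto_increments hX)
    rw [h.map_eq_zero_of_tendsto hv] at h1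
    exact h1.congr fun k => by simp
  have hZ := tendsto_inv_smul_of_tendsto_increments hv
  have hinv := tendsto_inv_atTop_nhds_zero_nat (𝕜 := ℝ)
  have hYB : ∀ k, ‖Y (k + 1) - Y k‖ ≤ ρ * B := fun k => by
    rw [h.Y_succ k, add_sub_cancel_left, norm_smul, Real.norm_of_nonneg hρ.le]
    exact mul_le_mul_of_nonneg_left (hB k).2 hρ.le
  obtain ⟨i₀, hi₀⟩ : ∃ i₀, ∀ i, i₀ ≤ i → ∀ j, i₀ ≤ j →
      ‖H‖ * ‖(Z j - X j) - (Z i - X i)‖ * M ≤ c / 4 := by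
    obtain ⟨N, hN⟩ := Metric.cauchySeq_iff.1 hδ.cauchySeq (c / 4 / (‖H‖ * M + 1)) (by positivity)
    refine ⟨N, fun i hi j hj => ?_⟩
    have h1 := (hN j hj i hi).le
    rw [dist_eq_norm, le_div_iff₀ (by positivity)] at h1
    nlinarith [norm_nonneg ((Z j - X j) - (Z i - X i))]
  refine not_increments_inner_decreasing (y := Y) (κ := ρ * (β * (c / 4)))
    (by positivity) i₀ hYB fun i hi => ?_
  have hZi : Tendsto (fun k : ℕ => (k : ℝ)⁻¹ • (Z k - Z i)) atTop (𝓝 v) := by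
    have h1 := hZ.sub (hinv.smul_const (Z i))
    rw [zero_smul, sub_zero] at h1
    exact h1.congr fun k => (smul_sub _ _ _).symm
  have hHZ : Tendsto (fun k : ℕ => ⟪W k - Y k, H ((k : ℝ)⁻¹ • (Z k - Z i))⟫) atTop (𝓝 0) := by
    have h1 : Tendsto (fun k : ℕ => H ((k : ℝ)⁻¹ • (Z k - Z i)) - H v) atTop (𝓝 0) := by
      simpa using ((H.continuous.tendsto _).comp hZi).sub_const (H v)
    have h2 := (tendsto_inner_zero_of_bounded h1 fun k => (hB k).2).add
      (h.tendsto_inner_dual_displacement hv)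
    rw [add_zero] at h2
    refine h2.congr fun k => ?_
    rw [real_inner_comm, ← inner_add_right, sub_add_cancel]
  have hR : Tendsto (fun k : ℕ => -(α⁻¹ * ⟪Z k - X k, (k : ℝ)⁻¹ • (Z k - Z i)⟫)
      - ⟪(k : ℝ)⁻¹ • P (X k), (Z k - X k) - Z i⟫ - ⟪q, (k : ℝ)⁻¹ • (Z k - Z i)⟫
      + ⟪W k - Y k, H ((k : ℝ)⁻¹ • (Z k - Z i))⟫) atTop (𝓝 (-c)) := by
    have h1 := (((hδ.inner hZi).const_mul α⁻¹).neg.sub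
      (hPX.inner (hδ.sub_const (Z i)))).sub ((tendsto_const_nhds (x := q)).inner hZi)
    have h2 := h1.add hHZ
    convert h2 using 2
    rw [real_inner_smul_left, real_inner_self_eq_norm_sq, inner_zero_left, hc_def]
    ring
  have hε : Tendsto (fun k : ℕ => β⁻¹ * ⟪(k : ℝ)⁻¹ • ((W k - Y k) - (W i - Y i)), W k - Y k⟫)
      atTop (𝓝 0) := by
    have h1 : Tendsto (fun k : ℕ => (k : ℝ)⁻¹ • ((W k - Y k) - (W i - Y i))) atTop (𝓝 0) := by
      have h3 : Tendsto (fun k : ℕ => (k : ℝ)⁻¹ * (B + B)) atTop (𝓝 0) := by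
        simpa using hinv.mul_const (B + B)
      refine squeeze_zero_norm (fun k => ?_) h3
      rw [norm_smul, norm_inv, Real.norm_natCast]
      gcongr
      exact (norm_sub_le _ _).trans (add_le_add (hB k).2 (hB i).2)
    simpa using (tendsto_inner_zero_of_bounded h1 fun k => (hB k).2).const_mul β⁻¹
  filter_upwards [hR.eventually_lt_const (show -c < -c + c / 4 by linarith),
    hε.eventually_const_lt (show -(c / 4) < 0 by linarith), eventually_ge_atTop i₀,
    eventually_ge_atTop 1] with j hRj hεj hji hj1
  have hjpos : (0 : ℝ) < j := by exact_mod_cast hj1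
  have hcross : ⟪H ((Z j - X j) - (Z i - X i)), (j : ℝ)⁻¹ • W j⟫ ≤ c / 4 := by
    refine (real_inner_le_norm _ _).trans (le_trans ?_ (hi₀ i hi j hji))
    gcongr
    · exact H.le_opNorm _
    · exact hM j
  have hmain := mul_le_mul_of_nonneg_left (h.two_point_inequality hzero hadd i j)
    (inv_nonneg.2 hjpos.le)
  have hWY : ⟪(W j - Y j) - (W i - Y i), W j⟫ =
      ⟪(W j - Y j) - (W i - Y i), Y j⟫ + ⟪(W j - Y j) - (W i - Y i), W j - Y j⟫ := by
    rw [← inner_add_right]; congr 1; abel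
  simp only [map_smul, real_inner_smul_left, real_inner_smul_right] at hRj hεj hcross
  rw [hWY] at hmain
  have hfinal : (j : ℝ)⁻¹ * (β⁻¹ * ⟪(W j - Y j) - (W i - Y i), Y j⟫) ≤ -(c / 4) := by linarith
  rw [inv_mul_le_iff₀ hjpos, inv_mul_le_iff₀ hβ, inner_sub_left] at hfinal
  rw [h.Y_succ j, h.Y_succ i, add_sub_cancel_left, add_sub_cancel_left, real_inner_smul_left,
    real_inner_smul_left]
  have := mul_le_mul_of_nonneg_left hfinal hρ.le
  linarith

end IsPrimalDualOrbit

end Orbit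

lemma inner_nonpos_of_eq_inv_smul {E : Type*} [NormedAddCommGroup E] [InnerProductSpace ℝ E]
    {c : ℝ} (hc : 0 < c) {x y d : E} (hxy : x = c⁻¹ • y) (h : ⟪y, d⟫ ≤ 0) : ⟪x, d⟫ ≤ 0 := by
  rw [hxy, real_inner_smul_left]
  exact mul_nonpos_of_nonneg_of_nonpos (inv_nonneg.2 hc.le) h

lemma exists_metricForm_coercive_of_norm_lt {E F : Type*} [NormedAddCommGroup E]
    [InnerProductSpace ℝ E] [NormedAddCommGroup F] [InnerProductSpace ℝ F] {P : E →L[ℝ] E}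
    {H : E →L[ℝ] F} {α β : ℝ} (hα : 0 < α) (hβ : 0 < β) (hstep : α * (‖P‖ + β * ‖H‖ ^ 2) < 1) :
    ∃ μ > 0, ∀ x y, μ * (‖x‖ ^ 2 + ‖y‖ ^ 2) ≤ metricForm P H α β x y := by
  have hs : 0 < α⁻¹ - ‖P‖ - β * ‖H‖ ^ 2 := by
    have : ‖P‖ + β * ‖H‖ ^ 2 < α⁻¹ := by
      simpa using (lt_inv_mul_iff₀ hα).2 hstep
    linarith
  set s := α⁻¹ - ‖P‖ - β * ‖H‖ ^ 2 with hs_def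
  have hK : 0 < (1 + 2 * (β * ‖H‖) ^ 2) / s + 2 * β := by positivity
  refine ⟨_, inv_pos.2 hK, fun x y => ?_⟩
  rw [inv_mul_le_iff₀ hK]
  have h1 : ⟪P x, x⟫ ≤ ‖P‖ * ‖x‖ ^ 2 := by
    calc ⟪P x, x⟫ ≤ ‖P x‖ * ‖x‖ := real_inner_le_norm _ _
      _ ≤ ‖P‖ * ‖x‖ * ‖x‖ := by gcongr; exact P.le_opNorm x
      _ = _ := by ring
  have h2 : ⟪H x, y⟫ ≤ ‖H‖ * ‖x‖ * ‖y‖ := by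
    calc ⟪H x, y⟫ ≤ ‖H x‖ * ‖y‖ := real_inner_le_norm _ _
      _ ≤ _ := by gcongr; exact H.le_opNorm x
  set t := ‖y‖ - β * ‖H‖ * ‖x‖ with ht
  have h3 : s * ‖x‖ ^ 2 + β⁻¹ * t ^ 2 ≤ metricForm P H α β x y := by
    have : β⁻¹ * t ^ 2 = β⁻¹ * ‖y‖ ^ 2 - 2 * (‖H‖ * ‖x‖ * ‖y‖) + β * ‖H‖ ^ 2 * ‖x‖ ^ 2 := by
      rw [ht]; field_simp; ring
    rw [this, hs_def, metricForm]
    linarith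
  refine le_trans ?_ (mul_le_mul_of_nonneg_left h3 hK.le)
  have h4 : ((1 + 2 * (β * ‖H‖) ^ 2) / s + 2 * β) * (s * ‖x‖ ^ 2 + β⁻¹ * t ^ 2) =
      (1 + 2 * (β * ‖H‖) ^ 2) * ‖x‖ ^ 2 + 2 * t ^ 2
        + (2 * β * s * ‖x‖ ^ 2 + (1 + 2 * (β * ‖H‖) ^ 2) / s * (β⁻¹ * t ^ 2)) := by
    field_simp
    ring
  have h5 : 0 ≤ 2 * β * s * ‖x‖ ^ 2 + (1 + 2 * (β * ‖H‖) ^ 2) / s * (β⁻¹ * t ^ 2) := by positivity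
  rw [h4]
  have h6 : ‖y‖ = t + β * ‖H‖ * ‖x‖ := by rw [ht]; ring
  rw [h6]
  linarith [sq_nonneg (t - β * ‖H‖ * ‖x‖)]

lemma exists_metricForm_coercive {n m : ℕ} {P : Matrix (Fin n) (Fin n) ℝ}
    {H : Matrix (Fin m) (Fin n) ℝ} {α β : ℝ} (hα : 0 < α) (hβ : 0 < β)
    (hstep : α * (specNorm P + β * specNorm H ^ 2) < 1) :
    ∃ μ > 0, ∀ x y, μ * (‖x‖ ^ 2 + ‖y‖ ^ 2) ≤
      metricForm (LinearMap.toContinuousLinearMap (Matrix.toEuclideanLin P))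
        (LinearMap.toContinuousLinearMap (Matrix.toEuclideanLin H)) α β x y :=
  exists_metricForm_coercive_of_norm_lt hα hβ hstep

lemma inner_toEuclideanLin_transpose {ι κ : Type*} [Fintype ι] [Fintype κ] [DecidableEq ι]
    [DecidableEq κ] (H : Matrix ι κ ℝ) (y : EuclideanSpace ℝ ι) (x : EuclideanSpace ℝ κ) :
    ⟪LinearMap.toContinuousLinearMap (Matrix.toEuclideanLin Hᵀ) y, x⟫ =
      ⟪y, LinearMap.toContinuousLinearMap (Matrix.toEuclideanLin H) x⟫ := by
  have h := Matrix.toEuclideanLin_conjTranspose_eq_adjoint H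
  rw [Matrix.conjTranspose_eq_transpose_of_trivial] at h
  rw [LinearMap.coe_toContinuousLinearMap', LinearMap.coe_toContinuousLinearMap', h,
    LinearMap.adjoint_inner_left]

lemma inner_toEuclideanLin_symm {ι : Type*} [Fintype ι] [DecidableEq ι] {P : Matrix ι ι ℝ}
    (hP : P.PosSemidef) (x y : EuclideanSpace ℝ ι) :
    ⟪LinearMap.toContinuousLinearMap (Matrix.toEuclideanLin P) x, y⟫ =
      ⟪x, LinearMap.toContinuousLinearMap (Matrix.toEuclideanLin P) y⟫ := by
  have h := hP.isHermitian.eq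
  rw [Matrix.conjTranspose_eq_transpose_of_trivial] at h
  rw [← inner_toEuclideanLin_transpose P, h]

lemma inner_toEuclideanLin_nonneg {ι : Type*} [Fintype ι] [DecidableEq ι] {P : Matrix ι ι ℝ}
    (hP : P.PosSemidef) (x : EuclideanSpace ℝ ι) :
    0 ≤ ⟪LinearMap.toContinuousLinearMap (Matrix.toEuclideanLin P) x, x⟫ := by
  have h := (Matrix.isPositive_toEuclideanLin_iff.2 hP).re_inner_nonneg_left x
  simpa using h

lemma proj_spec {ι : Type*} [Fintype ι] {C : Set (EuclideanSpace ℝ ι)} (hne : C.Nonempty)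
    (hcl : IsClosed C) (hcv : Convex ℝ C) (x : EuclideanSpace ℝ ι) :
    proj C x ∈ C ∧ ∀ y ∈ C, ⟪x - proj C x, y - proj C x⟫ ≤ 0 := by
  have hbdd : ∀ y : C, BddBelow (Set.range fun c : C => ‖x - c‖) := fun _ =>
    ⟨0, by rintro _ ⟨c, rfl⟩; exact norm_nonneg _⟩
  have hex : ∃ y ∈ C, ∀ c ∈ C, ‖x - y‖ ≤ ‖x - c‖ := by
    obtain ⟨y, hy, hmin⟩ := exists_norm_eq_iInf_of_complete_convex hne hcl.isComplete hcv x
    exact ⟨y, hy, fun c hc => hmin.trans_le (ciInf_le (hbdd ⟨c, hc⟩) ⟨c, hc⟩)⟩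
  rw [proj, dif_pos hex]
  obtain ⟨hmem, hmin⟩ := hex.choose_spec
  refine ⟨hmem, (norm_eq_iInf_iff_real_inner_le_zero hcv hmem).1 (le_antisymm ?_ ?_)⟩
  · have : Nonempty C := hne.to_subtype
    exact le_ciInf fun c => hmin c c.2
  · exact ciInf_le (hbdd ⟨_, hmem⟩) ⟨_, hmem⟩

section PolarCone

variable {ι : Type*} [Fintype ι] (K : Set (EuclideanSpace ℝ ι))

lemma zero_mem_polarCone_s11 : 0 ∈ polarCone K := fun y _ => (inner_zero_left y).le

lemma add_mem_polarCone : ∀ x ∈ polarCone K, ∀ y ∈ polarCone K, x + y ∈ polarCone K := by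
  intro x hx y hy u hu
  rw [inner_add_left]
  exact add_nonpos (hx u hu) (hy u hu)

lemma convex_polarCone_s11 : Convex ℝ (polarCone K) := by
  intro x hx y hy a b ha hb _ u hu
  rw [inner_add_left, real_inner_smul_left, real_inner_smul_left]
  exact add_nonpos (mul_nonpos_of_nonneg_of_nonpos ha (hx u hu))
    (mul_nonpos_of_nonneg_of_nonpos hb (hy u hu))

lemma isClosed_polarCone_s11 : IsClosed (polarCone K) := by
  have : polarCone K = ⋂ y ∈ K, {w | ⟪w, y⟫ ≤ 0} := by
    ext w; simp [polarCone]
  rw [this]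
  exact isClosed_biInter fun y _ =>
    isClosed_le (continuous_id.inner continuous_const) continuous_const

variable {K}

/-- A closed convex cone contains its bipolar. -/
lemma mem_of_inner_polarCone_nonpos (hne : K.Nonempty) (hK : IsClosedConvexCone K)
    {x : EuclideanSpace ℝ ι} (hx : ∀ y ∈ polarCone K, ⟪x, y⟫ ≤ 0) : x ∈ K := by
  obtain ⟨hcl, hcv, hcone⟩ := hK
  by_contra hxK
  obtain ⟨f, u, hf, hfx⟩ := geometric_hahn_banach_closed_point hcv hcl hxK
  have hzero : (0 : EuclideanSpace ℝ ι) ∈ K := by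
    obtain ⟨k, hk⟩ := hne
    simpa using hcone k hk 0 le_rfl
  have hu : 0 < u := by simpa using hf 0 hzero
  have hmem : (InnerProductSpace.toDual ℝ _).symm f ∈ polarCone K := by
    intro y hy
    rw [InnerProductSpace.toDual_symm_apply]
    by_contra! hpos
    have h1 := hf _ (hcone y hy (u / f y) (by positivity))
    rw [map_smul, smul_eq_mul, div_mul_cancel₀ _ hpos.ne'] at h1
    exact lt_irrefl _ h1
  have h1 := hx _ hmem
  rw [real_inner_comm, InnerProductSpace.toDual_symm_apply] at h1
  linarith

end PolarCone

/-- a nonzero limit `z̄` is a proof of dual infeasibility: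
`Pz̄ = 0`, `⟨q, z̄⟩ < 0`, `Hz̄ ∈ K`, and `z + z̄ ∈ D` for every `z ∈ D`. -/
theorem stmt11 {n m : ℕ} (P : Matrix (Fin n) (Fin n) ℝ) (q : EuclideanSpace ℝ (Fin n))
    (H : Matrix (Fin m) (Fin n) ℝ) (g : EuclideanSpace ℝ (Fin m))
    (D : Set (EuclideanSpace ℝ (Fin n))) (K : Set (EuclideanSpace ℝ (Fin m)))
    (hP : P.PosSemidef)
    (hDne : D.Nonempty) (hDcl : IsClosed D) (hDcv : Convex ℝ D)
    (hKne : K.Nonempty) (hK : IsClosedConvexCone K)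
    (α β ρ : ℝ) (hα : 0 < α) (hβ : 0 < β)
    (hstep : α * (specNorm P + β * specNorm H ^ 2) < 1)
    (hρ : ρ ∈ Set.Ioo (0 : ℝ) 2)
    (z ξ : ℕ → EuclideanSpace ℝ (Fin n)) (w η : ℕ → EuclideanSpace ℝ (Fin m))
    (hz : ∀ j, 1 ≤ j → z (j + 1) = proj D (ξ j - α • (mvec P (ξ j) + q + mvec Hᵀ (η j))))
    (hw : ∀ j, 1 ≤ j → w (j + 1) =
      proj (polarCone K) (η j + β • (mvec H ((2 : ℝ) • z (j + 1) - ξ j) - g)))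
    (hξ : ∀ j, 1 ≤ j → ξ (j + 1) = (1 - ρ) • ξ j + ρ • z (j + 1))
    (hη : ∀ j, 1 ≤ j → η (j + 1) = (1 - ρ) • η j + ρ • w (j + 1)) :
    ∀ zbar : EuclideanSpace ℝ (Fin n),
      Tendsto (fun j : ℕ => z (j + 1) - z j) atTop (𝓝 zbar) → zbar ≠ 0 →
      mvec P zbar = 0 ∧ ⟪q, zbar⟫ < 0 ∧ mvec H zbar ∈ K ∧ ∀ zz ∈ D, zz + zbar ∈ D := by
  intro zbar hlim hne
  have hz1 : Tendsto (fun k => z (k + 1 + 2) - z (k + 2)) atTop (𝓝 zbar) :=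
    (hlim.comp (tendsto_add_atTop_nat 2)).congr fun k => rfl
  have horb : IsPrimalDualOrbit (LinearMap.toContinuousLinearMap (Matrix.toEuclideanLin P))
      (LinearMap.toContinuousLinearMap (Matrix.toEuclideanLin H))
      (LinearMap.toContinuousLinearMap (Matrix.toEuclideanLin Hᵀ)) q g D (polarCone K) α β ρ
      (fun k => z (k + 2)) (fun k => ξ (k + 1)) (fun k => w (k + 2)) (fun k => η (k + 1)) := by
    have hD : ∀ k, _ := fun k => proj_spec hDne hDcl hDcv
      (ξ (k + 1) - α • (mvec P (ξ (k + 1)) + q + mvec Hᵀ (η (k + 1))))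
    have hC : ∀ k, _ := fun k => proj_spec (C := polarCone K) ⟨0, zero_mem_polarCone_s11 K⟩
      (isClosed_polarCone_s11 K) (convex_polarCone_s11 K)
      (η (k + 1) + β • (mvec H ((2 : ℝ) • z (k + 1 + 1) - ξ (k + 1)) - g))
    simp only [← hz _ (Nat.le_add_left 1 _), ← hw _ (Nat.le_add_left 1 _)] at hD hC
    refine
      { symm := inner_toEuclideanLin_symm hP
        nonneg := inner_toEuclideanLin_nonneg hP
        adj := inner_toEuclideanLin_transpose H
        α_pos := hα
        β_pos := hβ
        ρ_mem := hρ
        coercive := exists_metricForm_coercive hα hβ hstep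
        X_succ := fun k => ?_
        Y_succ := fun k => ?_
        Z_mem := fun k => (hD k).1
        W_mem := fun k => (hC k).1
        Z_normal := fun k x hx => ?_
        W_normal := fun k y hy => ?_ }
    · rw [hξ (k + 1) (Nat.le_add_left 1 _)]
      module
    · rw [hη (k + 1) (Nat.le_add_left 1 _)]
      module
    · refine inner_nonpos_of_eq_inv_smul hα ?_ ((hD k).2 x hx)
      simp only [mvec, LinearMap.coe_toContinuousLinearMap', smul_add, smul_sub,
        inv_smul_smul₀ hα.ne']
      abel
    · refine inner_nonpos_of_eq_inv_smul hβ ?_ ((hC k).2 y hy)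
      simp only [mvec, LinearMap.coe_toContinuousLinearMap', smul_add, smul_sub,
        inv_smul_smul₀ hβ.ne']
      abel
  refine ⟨horb.map_eq_zero_of_tendsto hz1, ?_, ?_, fun zz hzz =>
    horb.add_limit_mem hDcl hDcv hz1 hzz⟩
  · have h1 := horb.inner_add_norm_sq_nonpos (zero_mem_polarCone_s11 K) (add_mem_polarCone K) hz1
    have h2 : 0 < α⁻¹ * (ρ⁻¹ * ‖zbar‖ ^ 2) :=
      mul_pos (inv_pos.2 hα) (mul_pos (inv_pos.2 hρ.1) (pow_pos (norm_pos_iff.2 hne) 2))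
    linarith
  · exact mem_of_inner_polarCone_nonpos hKne hK fun y hy =>
      horb.inner_map_limit_nonpos (add_mem_polarCone K) hz1 hy
end

section
/- Suppose α, β > 0 and ρ ∈ (0, 2), and let (z^j, w^j, ξ^j, η^j) be the xPIPG iterates from arbitrary initial points ξ¹ ∈ ℝ^n, η¹ ∈ ℝ^m. Then for every j ≥ 1: d(−Pz^{j+1} − q − Hᵀw^{j+1} | N_D(z^{j+1})) ≤ ‖((1/α)Iₙ − P)(z^{j+1} − ξ^j) − Hᵀ(w^{j+1} − η^j)‖ and d(Hz^{j+1} − g | N_{K°}(w^{j+1})) ≤ ‖(1/β)(w^{j+1} − η^j) − H(z^{j+1} − ξ^j)‖. -/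
open scoped RealInnerProductSpace
open Filter Topology Matrix

theorem polarCone_nonempty {ι : Type*} [Fintype ι] (K : Set (EuclideanSpace ℝ ι)) :
    (polarCone K).Nonempty := ⟨0, fun y _ => by simp⟩

/-- The distance from `v` to the normal cone at `p = proj C x` is at most the distance from `v`
to the rescaled projection residual `c • (x - p)`. -/
theorem infDist_normalCone_proj_le {ι : Type*} [Fintype ι] {C : Set (EuclideanSpace ℝ ι)}
    (hne : C.Nonempty) (hcl : IsClosed C) (hcv : Convex ℝ C) {x p : EuclideanSpace ℝ ι}
    (hp : p = proj C x) {c : ℝ} (hc : 0 ≤ c) (v : EuclideanSpace ℝ ι) :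
    Metric.infDist v (normalCone C p) ≤ ‖v - c • (x - p)‖ := by
  subst hp
  rw [← dist_eq_norm]
  exact Metric.infDist_le_dist_of_mem
    (smul_mem_normalCone (sub_proj_mem_normalCone hne hcl hcv x) hc)

/-- per-iteration bounds on the distances to the normal cones in terms of
successive xPIPG iterates. -/
theorem stmt12 {n m : ℕ} (P : Matrix (Fin n) (Fin n) ℝ) (q : EuclideanSpace ℝ (Fin n))
    (H : Matrix (Fin m) (Fin n) ℝ) (g : EuclideanSpace ℝ (Fin m))
    (D : Set (EuclideanSpace ℝ (Fin n))) (K : Set (EuclideanSpace ℝ (Fin m)))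
    (hP : P.PosSemidef)
    (hDne : D.Nonempty) (hDcl : IsClosed D) (hDcv : Convex ℝ D)
    (hKne : K.Nonempty) (hK : IsClosedConvexCone K)
    (α β ρ : ℝ) (hα : 0 < α) (hβ : 0 < β)
    (hρ : ρ ∈ Set.Ioo (0 : ℝ) 2)
    (z ξ : ℕ → EuclideanSpace ℝ (Fin n)) (w η : ℕ → EuclideanSpace ℝ (Fin m))
    (hz : ∀ j, 1 ≤ j → z (j + 1) = proj D (ξ j - α • (mvec P (ξ j) + q + mvec Hᵀ (η j))))
    (hw : ∀ j, 1 ≤ j → w (j + 1) =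
      proj (polarCone K) (η j + β • (mvec H ((2 : ℝ) • z (j + 1) - ξ j) - g)))
    (hξ : ∀ j, 1 ≤ j → ξ (j + 1) = (1 - ρ) • ξ j + ρ • z (j + 1))
    (hη : ∀ j, 1 ≤ j → η (j + 1) = (1 - ρ) • η j + ρ • w (j + 1)) :
    ∀ j, 1 ≤ j →
      Metric.infDist (-(mvec P (z (j + 1))) - q - mvec Hᵀ (w (j + 1)))
          (normalCone D (z (j + 1))) ≤
        ‖mvec ((1 / α) • (1 : Matrix (Fin n) (Fin n) ℝ) - P) (z (j + 1) - ξ j) -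
          mvec Hᵀ (w (j + 1) - η j)‖ ∧
      Metric.infDist (mvec H (z (j + 1)) - g) (normalCone (polarCone K) (w (j + 1))) ≤
        ‖(1 / β) • (w (j + 1) - η j) - mvec H (z (j + 1) - ξ j)‖ := by
  intro j hj
  constructor
  · refine (infDist_normalCone_proj_le hDne hDcl hDcv (hz j hj) (one_div_pos.2 hα).le _).trans_eq
      (congrArg norm ?_)
    simp only [mvec, map_sub, LinearMap.sub_apply, map_smul, LinearMap.smul_apply,
      Matrix.toLpLin_one, LinearMap.id_apply]
    match_scalars <;> field_simp <;> ring
  · refine (infDist_normalCone_proj_le (polarCone_nonempty K) (isClosed_polarCone K)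
      (convex_polarCone K) (hw j hj) (one_div_pos.2 hβ).le _).trans_eq (congrArg norm ?_)
    simp only [mvec, map_sub, map_smul]
    match_scalars <;> field_simp <;> ring
end
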